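/- If two effective n-forms on a symplectic vector space (V, Ω) of dimension 2n vanish on exactly the same n-dimensional isotropic (lagrangian) subspaces of V, then they are proportional. -/

import Mathlib

/- Framework: exterior forms on a real vector space `V` are modelled as elements of the
exterior algebra of the dual space; a `k`-form is an element of the submodule
`⋀[ℝ]^k (Module.Dual ℝ V)`, and the wedge product is the algebra multiplication. -/

noncomputable section
open ExteriorAlgebra
set_option synthInstance.maxHeartbeats 1000000
set_option maxHeartbeats 1000000

variable (V : Type) [AddCommGroup V] [Module ℝ V]

/-- The algebra of exterior forms on `V`. -/
abbrev EForm := ExteriorAlgebra ℝ (Module.Dual ℝ V)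

variable {V}

/-- Interior product (contraction) of forms by a vector, linear in the vector. -/
def iContrL : V →ₗ[ℝ] Module.End ℝ (EForm V) :=
  (CliffordAlgebra.contractLeft (Q := (0 : QuadraticForm ℝ (Module.Dual ℝ V)))).comp
    (Module.Dual.eval ℝ V)

/-- Contraction of forms by an arbitrary element of the exterior algebra of `V`
(e.g. by a bivector), extending `iContrL` as an algebra morphism. -/
def aContr : ExteriorAlgebra ℝ V →ₐ[ℝ] Module.End ℝ (EForm V) :=
  ExteriorAlgebra.lift ℝ ⟨iContrL, fun _ =>
    LinearMap.ext fun _ => CliffordAlgebra.contractLeft_contractLeft _ _⟩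

/-- The bilinear form on `V` associated with an exterior 2-form, via double contraction
(the scalar part is extracted by `ExteriorAlgebra.algebraMapInv`). -/
def formToBilin (Om : EForm V) : V →ₗ[ℝ] V →ₗ[ℝ] ℝ :=
  LinearMap.mk₂ ℝ (fun x y => algebraMapInv (iContrL y (iContrL x Om)))
    (fun x x' y => by simp [map_add, LinearMap.add_apply])
    (fun c x y => by simp [map_smul, LinearMap.smul_apply])
    (fun x y y' => by simp [map_add, LinearMap.add_apply])
    (fun c x y => by simp [map_smul, LinearMap.smul_apply])

/-- A 2-form is nondegenerate (symplectic) if its associated bilinear form is. -/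
def IsSymplecticForm (Om : EForm V) : Prop :=
  Om ∈ ⋀[ℝ]^2 (Module.Dual ℝ V) ∧ ∀ x : V, (∀ y : V, formToBilin Om x y = 0) → x = 0

/-- The algebra morphism `⋀ V → ⋀ V*` induced by a linear map `Γ : V → V*`. -/
def extAlgMap (f : V →ₗ[ℝ] Module.Dual ℝ V) : ExteriorAlgebra ℝ V →ₐ[ℝ] EForm V :=
  ExteriorAlgebra.lift ℝ ⟨(ExteriorAlgebra.ι ℝ).comp f, fun _ => ι_sq_zero _⟩

/-- `XOm` is the bivector dual to the symplectic form `Om`, i.e. the unique bivector with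
`Γ^*(X_Ω) = Ω` where `Γ : V → V*` is the isomorphism induced by `Om`. -/
def IsDualBivector (Om : EForm V) (XOm : ExteriorAlgebra ℝ V) : Prop :=
  XOm ∈ ⋀[ℝ]^2 V ∧ extAlgMap (formToBilin Om) XOm = Om

/-- The pullback action on forms induced by an endomorphism `K : V → V`. -/
def formPullback (K : V →ₗ[ℝ] V) : EForm V →ₐ[ℝ] EForm V :=
  ExteriorAlgebra.lift ℝ ⟨(ExteriorAlgebra.ι ℝ).comp K.dualMap, fun _ => ι_sq_zero _⟩


/-- A `k`-form vanishes on a subspace `L` if it evaluates to zero on any `k`-tuple of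
vectors of `L` (evaluation via iterated contraction). -/
def VanishesOn (k : ℕ) (ω : EForm V) (L : Submodule ℝ V) : Prop :=
  ∀ v : Fin k → V, (∀ i, v i ∈ L) → (List.ofFn fun i => iContrL (v i)).prod ω = 0

/-- Leibniz rule for contraction against a product with a `1`-form. -/
lemma iContrL_ι_mul (x : V) (a : Module.Dual ℝ V) (b : EForm V) :
    iContrL x (ι ℝ a * b) = a x • b - ι ℝ a * iContrL x b :=
  CliffordAlgebra.contractLeft_ι_mul (Q := (0 : QuadraticForm ℝ (Module.Dual ℝ V))) _ a b

lemma iContrL_ι (x : V) (a : Module.Dual ℝ V) :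
    iContrL x (ι ℝ a) = algebraMap ℝ _ (a x) :=
  CliffordAlgebra.contractLeft_ι (Q := (0 : QuadraticForm ℝ (Module.Dual ℝ V))) _ a

lemma iContrL_algebraMap (x : V) (r : ℝ) :
    iContrL x (algebraMap ℝ (EForm V) r) = 0 :=
  CliffordAlgebra.contractLeft_algebraMap (Q := (0 : QuadraticForm ℝ (Module.Dual ℝ V))) _ r

lemma iContrL_comm (x y : V) (b : EForm V) :
    iContrL x (iContrL y b) = -iContrL y (iContrL x b) :=
  CliffordAlgebra.contractLeft_comm (Q := (0 : QuadraticForm ℝ (Module.Dual ℝ V))) _ _ b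

lemma iContrL_self (x : V) (b : EForm V) : iContrL x (iContrL x b) = 0 :=
  CliffordAlgebra.contractLeft_contractLeft (Q := (0 : QuadraticForm ℝ (Module.Dual ℝ V))) _ b

/-- The operator `α ∧ i_e` on forms. -/
def wedgeContr (α : Module.Dual ℝ V) (e : V) : Module.End ℝ (EForm V) :=
  LinearMap.mulLeft ℝ (ι ℝ α) * iContrL e

lemma wedgeContr_apply (α : Module.Dual ℝ V) (e : V) (b : EForm V) :
    wedgeContr α e b = ι ℝ α * iContrL e b := rfl

lemma iContrL_mul_wedgeContr (x : V) (α : Module.Dual ℝ V) (e : V) :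
    iContrL x * wedgeContr α e = α x • iContrL e + wedgeContr α e * iContrL x := by
  refine LinearMap.ext fun b => ?_
  simp only [Module.End.mul_apply, wedgeContr_apply, iContrL_ι_mul, LinearMap.add_apply,
    LinearMap.smul_apply, iContrL_comm x e b, mul_neg, sub_neg_eq_add]

/-- Iterated contraction by a tuple of vectors. -/
def multiContr {n : ℕ} (u : Fin n → V) : Module.End ℝ (EForm V) :=
  (List.ofFn fun i => iContrL (u i)).prod

lemma multiContr_succ {n : ℕ} (u : Fin (n + 1) → V) :
    multiContr u = iContrL (u 0) * multiContr (fun i => u i.succ) := by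
  simp [multiContr, List.ofFn_succ]

lemma multiContr_succ_last {n : ℕ} (u : Fin (n + 1) → V) :
    multiContr u = multiContr (fun i => u i.castSucc) * iContrL (u (Fin.last n)) := by
  rw [multiContr, List.ofFn_succ_last, List.prod_append, List.prod_singleton, multiContr]

lemma multiContr_mul_wedgeContr {n : ℕ} (u : Fin n → V) (α : Module.Dual ℝ V) (e : V) :
    multiContr u * wedgeContr α e =
      ∑ b, α (u b) • multiContr (Function.update u b e) + wedgeContr α e * multiContr u := by
  induction n with
  | zero => simp [multiContr]
  | succ n ih =>
    have h0 : (fun i : Fin n => Function.update u 0 e i.succ) = fun i => u i.succ := by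
      ext i; simp
    have h1 (b : Fin n) : (fun i : Fin n => Function.update u b.succ e i.succ) =
        Function.update (fun i => u i.succ) b e := by
      ext i; simp [Function.update_apply]
    have h2 (b : Fin n) : Function.update u b.succ e 0 = u 0 := by
      simp [(Fin.succ_ne_zero b).symm]
    simp only [multiContr_succ, Fin.sum_univ_succ, h0, h1, h2, mul_assoc, ih,
      Function.update_self]
    rw [mul_add, ← mul_assoc, iContrL_mul_wedgeContr, Finset.mul_sum, add_mul]
    simp only [smul_mul_assoc, mul_smul_comm, mul_assoc]
    abel

/-- Evaluation of a form on an `n`-tuple of vectors, as an alternating map. -/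
def evalForm (n : ℕ) (ω : EForm V) : V [⋀^Fin n]→ₗ[ℝ] ℝ :=
  ((algebraMapInv : EForm V →ₐ[ℝ] ℝ).toLinearMap ∘ₗ LinearMap.applyₗ ω ∘ₗ
    (aContr : ExteriorAlgebra ℝ V →ₐ[ℝ] Module.End ℝ (EForm V)).toLinearMap).compAlternatingMap
      (ιMulti ℝ n)

lemma evalForm_apply {n : ℕ} (ω : EForm V) (u : Fin n → V) :
    evalForm n ω u = algebraMapInv (multiContr u ω) := by
  simp [evalForm, multiContr, ιMulti_apply, map_list_prod, List.map_ofFn, aContr,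
    Function.comp_def]

lemma evalForm_sub_smul {n : ℕ} (ω₁ ω₂ : EForm V) (c : ℝ) (u : Fin n → V) :
    evalForm n (ω₂ - c • ω₁) u = evalForm n ω₂ u - c * evalForm n ω₁ u := by
  simp [evalForm_apply]

lemma evalForm_wedgeContr {n : ℕ} (ω : EForm V) (α : Module.Dual ℝ V) (e : V) (u : Fin n → V) :
    evalForm n (wedgeContr α e ω) u = ∑ b, α (u b) * evalForm n ω (Function.update u b e) := by
  have h := congrArg (fun f : Module.End ℝ (EForm V) => algebraMapInv (f ω))
    (multiContr_mul_wedgeContr u α e)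
  simp only [Module.End.mul_apply, LinearMap.add_apply, LinearMap.sum_apply,
    LinearMap.smul_apply, map_add, map_sum, map_smul, smul_eq_mul] at h
  simp only [evalForm_apply]
  rw [h, wedgeContr_apply, map_mul]
  simp [algebraMapInv]

/-- An additive property of `2`-forms may be checked on products of `1`-forms. -/
@[elab_as_elim]
lemma exteriorPower_two_induction {p : EForm V → Prop}
    (hmul : ∀ a b : Module.Dual ℝ V, p (ι ℝ a * ι ℝ b))
    (hadd : ∀ x y, p x → p y → p (x + y)) {Om : EForm V}
    (hOm : Om ∈ ⋀[ℝ]^2 (Module.Dual ℝ V)) : p Om := by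
  rw [exteriorPower, pow_two] at hOm
  refine Submodule.mul_induction_on hOm ?_ hadd
  rintro _ ⟨a, rfl⟩ _ ⟨b, rfl⟩
  exact hmul a b

lemma formToBilin_apply (Om : EForm V) (x y : V) :
    formToBilin Om x y = algebraMapInv (iContrL y (iContrL x Om)) := rfl

lemma formToBilin_add (Om Om' : EForm V) :
    formToBilin (Om + Om') = formToBilin Om + formToBilin Om' := by
  ext x y; simp [formToBilin_apply]

lemma formToBilin_ι_mul_ι (a b : Module.Dual ℝ V) (x y : V) :
    formToBilin (ι ℝ a * ι ℝ b) x y = a x * b y - b x * a y := by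
  simp [formToBilin_apply, iContrL_ι_mul, iContrL_ι, ← Algebra.commutes, ← Algebra.smul_def,
    algebraMap_leftInverse _ _]

lemma formToBilin_self (Om : EForm V) (x : V) : formToBilin Om x x = 0 := by
  simp [formToBilin_apply, iContrL_self]

lemma iContrL_two_form_mul {Om : EForm V} (hOm : Om ∈ ⋀[ℝ]^2 (Module.Dual ℝ V)) (x : V)
    (w : EForm V) :
    iContrL x (Om * w) = ι ℝ (formToBilin Om x) * w + Om * iContrL x w := by
  refine exteriorPower_two_induction (Om := Om) ?_ ?_ hOm
  · intro a b
    have : formToBilin (ι ℝ a * ι ℝ b) x = a x • b - b x • a := by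
      ext y; simp [formToBilin_ι_mul_ι]
    rw [this, mul_assoc, iContrL_ι_mul, iContrL_ι_mul]
    simp [sub_mul, mul_sub, mul_assoc]
    abel
  · intro y z hy hz
    simp only [add_mul, map_add, hy, hz, formToBilin_add, LinearMap.add_apply]
    abel

lemma two_form_mul_comm {Om : EForm V} (hOm : Om ∈ ⋀[ℝ]^2 (Module.Dual ℝ V)) (w : EForm V) :
    Om * w = w * Om := by
  refine exteriorPower_two_induction (Om := Om) ?_ ?_ hOm
  · intro a b
    induction w using ExteriorAlgebra.induction with
    | algebraMap r => exact (Algebra.commutes _ _).symm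
    | ι c =>
      have h1 := ι_add_mul_swap (R := ℝ) b c
      have h2 := ι_add_mul_swap (R := ℝ) a c
      rw [add_eq_zero_iff_eq_neg] at h1 h2
      rw [mul_assoc, h1, mul_neg, ← mul_assoc, h2]
      simp [mul_assoc]
    | mul x y hx hy => rw [← mul_assoc, hx, mul_assoc, hy, mul_assoc]
    | add x y hx hy => rw [mul_add, add_mul, hx, hy]
  · intro y z hy hz
    rw [add_mul, mul_add, hy, hz]

lemma iContrL_mem {k : ℕ} {ω : EForm V} (hω : ω ∈ ⋀[ℝ]^(k + 1) (Module.Dual ℝ V)) (x : V) :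
    iContrL x ω ∈ ⋀[ℝ]^k (Module.Dual ℝ V) := by
  induction k generalizing ω with
  | zero =>
    rw [exteriorPower, zero_add, pow_one] at hω
    obtain ⟨a, rfl⟩ := hω
    rw [iContrL_ι, exteriorPower, pow_zero]
    exact Submodule.algebraMap_mem _
  | succ k ih =>
    rw [exteriorPower, pow_succ'] at hω
    refine Submodule.mul_induction_on hω ?_ ?_
    · rintro _ ⟨a, rfl⟩ w hw
      rw [iContrL_ι_mul]
      refine Submodule.sub_mem _ (Submodule.smul_mem _ _ hw) ?_
      rw [exteriorPower, pow_succ']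
      exact Submodule.mul_mem_mul ⟨a, rfl⟩ (ih hw)
    · intro y z hy hz
      rw [map_add]
      exact Submodule.add_mem _ hy hz

lemma multiContr_mem {k : ℕ} {ω : EForm V} (hω : ω ∈ ⋀[ℝ]^k (Module.Dual ℝ V)) (u : Fin k → V) :
    multiContr u ω = algebraMap ℝ _ (evalForm k ω u) := by
  suffices h : multiContr u ω ∈ (1 : Submodule ℝ (EForm V)) by
    obtain ⟨r, hr⟩ := Submodule.mem_one.1 h
    rw [evalForm_apply, ← hr, algebraMap_leftInverse _ _]
  induction k generalizing ω with
  | zero => simpa [multiContr, exteriorPower] using hω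
  | succ k ih =>
    rw [multiContr_succ_last]
    exact ih (iContrL_mem hω _) _

lemma vanishesOn_iff {k : ℕ} {ω : EForm V} (hω : ω ∈ ⋀[ℝ]^k (Module.Dual ℝ V))
    (L : Submodule ℝ V) :
    VanishesOn k ω L ↔ ∀ v : Fin k → V, (∀ i, v i ∈ L) → evalForm k ω v = 0 := by
  refine forall₂_congr fun v _ => ?_
  change multiContr v ω = 0 ↔ _
  rw [multiContr_mem hω, algebraMap_eq_zero_iff]

/-- Euler's identity: `∑ eⁱ ∧ i_{eᵢ}` is multiplication by the degree. -/
lemma sum_wedgeContr {I : Type*} [Fintype I] (e : Module.Basis I ℝ V) {k : ℕ} {ω : EForm V}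
    (hω : ω ∈ ⋀[ℝ]^k (Module.Dual ℝ V)) :
    ∑ i, wedgeContr (e.coord i) (e i) ω = (k : ℝ) • ω := by
  induction k generalizing ω with
  | zero =>
    rw [exteriorPower, pow_zero] at hω
    obtain ⟨r, rfl⟩ := Submodule.mem_one.1 hω
    simp [wedgeContr_apply, iContrL_algebraMap]
  | succ k ih =>
    rw [exteriorPower, pow_succ'] at hω
    refine Submodule.mul_induction_on hω ?_ ?_
    · rintro _ ⟨a, rfl⟩ w hw
      have ha : ∑ i, a (e i) • e.coord i = a := by
        refine e.ext fun j => ?_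
        simp
      have key (i : I) : wedgeContr (e.coord i) (e i) (ι ℝ a * w) =
          ι ℝ (a (e i) • e.coord i) * w + ι ℝ a * wedgeContr (e.coord i) (e i) w := by
        have h1 := ι_add_mul_swap (R := ℝ) (e.coord i) a
        rw [add_eq_zero_iff_eq_neg] at h1
        rw [wedgeContr_apply, wedgeContr_apply, iContrL_ι_mul, mul_sub, ← mul_assoc, h1]
        simp [mul_assoc]
      simp only [key, Finset.sum_add_distrib, ← Finset.sum_mul, ← Finset.mul_sum, ← map_sum, ha,
        ih hw]
      push_cast
      rw [add_smul, one_smul, mul_smul_comm, add_comm]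
    · intro y z hy hz
      simp only [map_add, Finset.sum_add_distrib, hy, hz, smul_add]

lemma eq_zero_of_evalForm_eq_zero [FiniteDimensional ℝ V] {k : ℕ} {ω : EForm V}
    (hω : ω ∈ ⋀[ℝ]^k (Module.Dual ℝ V)) (h : ∀ u, evalForm k ω u = 0) : ω = 0 := by
  induction k generalizing ω with
  | zero =>
    have := multiContr_mem hω Fin.elim0
    rw [h, map_zero] at this
    simpa [multiContr] using this
  | succ k ih =>
    have hz (x : V) : iContrL x ω = 0 := by
      refine ih (iContrL_mem hω x) fun u => ?_
      have := h (Fin.snoc u x)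
      rw [evalForm_apply, multiContr_succ_last] at this
      simpa [evalForm_apply] using this
    have := sum_wedgeContr (Module.finBasis ℝ V) hω
    simp only [wedgeContr_apply, hz, mul_zero, Finset.sum_const_zero] at this
    refine (smul_eq_zero.1 this.symm).resolve_left ?_
    positivity

/-- Evaluation of `Ω ∧ i_f i_e η`. -/
lemma evalForm_two_form_mul {n : ℕ} {Om : EForm V} (hOm : Om ∈ ⋀[ℝ]^2 (Module.Dual ℝ V))
    (η : EForm V) (e f : V) (u : Fin n → V) :
    2 * evalForm n (Om * iContrL f (iContrL e η)) u =
      ∑ b, ∑ c ∈ Finset.univ.erase b, formToBilin Om (u b) (u c) *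
        evalForm n η (Function.update (Function.update u b e) c f) := by
  refine exteriorPower_two_induction (Om := Om) ?_ ?_ hOm
  · intro p q
    have h1 : ι ℝ p * ι ℝ q * iContrL f (iContrL e η) =
        q f • wedgeContr p e η - wedgeContr p f (wedgeContr q e η) := by
      simp only [wedgeContr_apply, iContrL_ι_mul, mul_sub, mul_smul_comm, mul_assoc]
      abel
    have h2 : evalForm n (ι ℝ p * ι ℝ q * iContrL f (iContrL e η)) u =
        - ∑ b, ∑ c ∈ Finset.univ.erase b, p (u b) * q (u c) *
          evalForm n η (Function.update (Function.update u b f) c e) := by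
      have h3 : evalForm n (q f • wedgeContr p e η - wedgeContr p f (wedgeContr q e η)) u =
          q f * evalForm n (wedgeContr p e η) u
            - evalForm n (wedgeContr p f (wedgeContr q e η)) u := by
        simp [evalForm_apply]
      rw [h1, h3]
      simp only [evalForm_wedgeContr]
      rw [Finset.mul_sum, ← Finset.sum_sub_distrib, ← Finset.sum_neg_distrib]
      refine Finset.sum_congr rfl fun b _ => ?_
      rw [← Finset.add_sum_erase _ _ (Finset.mem_univ b), Function.update_self,
        Function.update_idem]
      have : ∑ c ∈ Finset.univ.erase b, q (Function.update u b f c) *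
            evalForm n η (Function.update (Function.update u b f) c e) =
          ∑ c ∈ Finset.univ.erase b, q (u c) *
            evalForm n η (Function.update (Function.update u b f) c e) :=
        Finset.sum_congr rfl fun c hc => by
          rw [Function.update_of_ne (Finset.ne_of_mem_erase hc)]
      rw [this, mul_add, Finset.mul_sum]
      simp only [mul_assoc]
      ring
    have swap (b c : Fin n) (hbc : b ≠ c) :
        evalForm n η (Function.update (Function.update u b f) c e) =
          - evalForm n η (Function.update (Function.update u b e) c f) := by
      rw [← (evalForm n η).map_swap _ hbc]
      congr 1
      ext i
      simp only [Function.comp_apply]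
      rcases eq_or_ne i b with rfl | hib
      · simp [hbc]
      rcases eq_or_ne i c with rfl | hic
      · simp [hbc]
      · simp [Equiv.swap_apply_of_ne_of_ne, hib, hic]
    have h4 : evalForm n (ι ℝ p * ι ℝ q * iContrL f (iContrL e η)) u =
        ∑ b, ∑ c ∈ Finset.univ.erase b, p (u b) * q (u c) *
          evalForm n η (Function.update (Function.update u b e) c f) := by
      rw [h2, ← Finset.sum_neg_distrib]
      refine Finset.sum_congr rfl fun b _ => ?_
      rw [← Finset.sum_neg_distrib]
      refine Finset.sum_congr rfl fun c hc => ?_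
      rw [swap b c (Finset.ne_of_mem_erase hc).symm]
      ring
    have h5 : evalForm n (ι ℝ p * ι ℝ q * iContrL f (iContrL e η)) u =
        - ∑ b, ∑ c ∈ Finset.univ.erase b, q (u b) * p (u c) *
          evalForm n η (Function.update (Function.update u b e) c f) := by
      rw [h2, neg_inj, Finset.sum_comm' (t' := Finset.univ) (s' := fun c => Finset.univ.erase c)]
      · refine Finset.sum_congr rfl fun b _ => Finset.sum_congr rfl fun c hc => ?_
        rw [Function.update_comm (Finset.ne_of_mem_erase hc)]
        ring
      · simp [eq_comm]
    rw [two_mul]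
    nth_rw 1 [h4]
    rw [h5, ← sub_eq_add_neg, ← Finset.sum_sub_distrib]
    refine Finset.sum_congr rfl fun b _ => ?_
    rw [← Finset.sum_sub_distrib]
    refine Finset.sum_congr rfl fun c _ => ?_
    rw [formToBilin_ι_mul_ι]
    ring
  · intro y z hy hz
    have : evalForm n ((y + z) * iContrL f (iContrL e η)) u =
        evalForm n (y * iContrL f (iContrL e η)) u
          + evalForm n (z * iContrL f (iContrL e η)) u := by
      simp [evalForm_apply, add_mul]
    rw [this, mul_add, hy, hz, formToBilin_add]
    simp only [LinearMap.add_apply, add_mul, Finset.sum_add_distrib]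

/-- An effective form, evaluated on a tuple orthogonal to a hyperbolic pair `e, f`. -/
lemma evalForm_effective {n : ℕ} {Om : EForm V} (hOm : Om ∈ ⋀[ℝ]^2 (Module.Dual ℝ V))
    {η : EForm V} (heff : η * Om = 0) {e f : V} (hef : formToBilin Om e f = 1) {u : Fin n → V}
    (hue : ∀ i, formToBilin Om e (u i) = 0) (huf : ∀ i, formToBilin Om f (u i) = 0) :
    2 * evalForm n η u + ∑ b, ∑ c ∈ Finset.univ.erase b, formToBilin Om (u b) (u c) *
        evalForm n η (Function.update (Function.update u b e) c f) = 0 := by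
  rw [← evalForm_two_form_mul hOm]
  have h : η - wedgeContr (formToBilin Om e) f η + wedgeContr (formToBilin Om f) e η
      + Om * iContrL f (iContrL e η) = 0 := by
    have := congrArg (fun w => iContrL f (iContrL e w)) ((two_form_mul_comm hOm η).trans heff)
    simp only [iContrL_two_form_mul hOm, map_add, map_zero, iContrL_ι_mul, hef, one_smul] at this
    simp only [wedgeContr_apply]
    rw [← this]
    abel
  have h' := congrArg (fun w => evalForm n w u) h
  have h0 : evalForm n (wedgeContr (formToBilin Om e) f η) u = 0 := by
    simp [evalForm_wedgeContr, hue]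
  have h1 : evalForm n (wedgeContr (formToBilin Om f) e η) u = 0 := by
    simp [evalForm_wedgeContr, huf]
  simp only [evalForm_apply, map_add, map_sub, map_zero] at h' h0 h1 ⊢
  rw [h0, h1] at h'
  linarith

section LagrangianTuples

variable {n : ℕ}

lemma AlternatingMap.map_add_smul_const (φ : V [⋀^Fin n]→ₗ[ℝ] ℝ) (x : Fin n → V)
    (a : Fin n → ℝ) (u : V) :
    φ (fun i => x i + a i • u) = φ x + ∑ i, a i * φ (Function.update x i u) := by
  suffices h : ∀ (S : Finset (Fin n)) (x : Fin n → V),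
      φ (fun i => x i + (if i ∈ S then a i else 0) • u) =
        φ x + ∑ i ∈ S, a i * φ (Function.update x i u) by
    simpa using h Finset.univ x
  intro S
  induction S using Finset.induction_on with
  | empty => simp
  | insert j S hj ih =>
    intro x
    have h1 : (fun i => x i + (if i ∈ insert j S then a i else 0) • u) =
        Function.update (fun i => x i + (if i ∈ S then a i else 0) • u) j (x j + a j • u) := by
      ext i
      rcases eq_or_ne i j with rfl | hij
      · simp
      · simp [hij]
    have h2 : Function.update (fun i => x i + (if i ∈ S then a i else 0) • u) j (x j) =
        fun i => x i + (if i ∈ S then a i else 0) • u := by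
      rw [Function.update_eq_self_iff]
      simp [hj]
    have h3 : Function.update (fun i => x i + (if i ∈ S then a i else 0) • u) j u =
        fun i => Function.update x j u i + (if i ∈ S then a i else 0) • u := by
      ext i
      rcases eq_or_ne i j with rfl | hij
      · simp [hj]
      · simp [hij]
    have h4 : ∑ i ∈ S, a i * φ (Function.update (Function.update x j u) i u) = 0 := by
      refine Finset.sum_eq_zero fun i hi => ?_
      have hij : i ≠ j := fun h => hj (h ▸ hi)
      rw [φ.map_eq_zero_of_eq _ (i := i) (j := j) (by simp [hij.symm]) hij, mul_zero]
    rw [h1, φ.map_update_add, φ.map_update_smul, h2, h3, ih, ih, h4, Finset.sum_insert hj,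
      smul_eq_mul]
    ring

/-- The transvection `x ↦ x + t B(x, u) u`. -/
def transvectionMap (B : V →ₗ[ℝ] V →ₗ[ℝ] ℝ) (u : V) (t : ℝ) : V →ₗ[ℝ] V :=
  LinearMap.id + t • (B.flip u).smulRight u

lemma transvectionMap_apply (B : V →ₗ[ℝ] V →ₗ[ℝ] ℝ) (u : V) (t : ℝ) (x : V) :
    transvectionMap B u t x = x + (t * B x u) • u := by
  simp [transvectionMap, mul_smul]

/-- The composite of transvections along a list of directions with given parameters. -/
def transvectionWord (B : V →ₗ[ℝ] V →ₗ[ℝ] ℝ) : List V → (ℕ → ℝ) → V →ₗ[ℝ] V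
  | [], _ => LinearMap.id
  | u :: us, t => transvectionWord B us (fun k => t (k + 1)) ∘ₗ transvectionMap B u (t 0)

lemma transvectionWord_zero (B : V →ₗ[ℝ] V →ₗ[ℝ] ℝ) (us : List V) :
    transvectionWord B us (fun _ => 0) = LinearMap.id := by
  induction us with
  | nil => rfl
  | cons u us ih => ext x; simp [transvectionWord, ih, transvectionMap_apply]

lemma transvectionMap_preserves {B : V →ₗ[ℝ] V →ₗ[ℝ] ℝ} (hB : B.IsAlt) (u : V) (t : ℝ)
    (x y : V) : B (transvectionMap B u t x) (transvectionMap B u t y) = B x y := by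
  simp only [transvectionMap_apply, map_add, map_smul, LinearMap.add_apply,
    LinearMap.smul_apply, smul_eq_mul, hB u, ← hB.neg y u]
  ring

lemma injective_of_preserves {B : V →ₗ[ℝ] V →ₗ[ℝ] ℝ} (hnd : ∀ x, (∀ y, B x y = 0) → x = 0)
    {T : V →ₗ[ℝ] V} (hT : ∀ x y, B (T x) (T y) = B x y) : LinearMap.ker T = ⊥ := by
  rw [LinearMap.ker_eq_bot']
  refine fun x hx => hnd x fun y => ?_
  rw [← hT, hx, map_zero, LinearMap.zero_apply]

lemma exists_eq_mul_of_affine {f₀ f₁ g₀ g₁ : ℝ}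
    (h : ∀ τ : ℝ, f₀ + f₁ * τ = 0 ↔ g₀ + g₁ * τ = 0) :
    ∃ c, f₀ = c * g₀ ∧ f₁ = c * g₁ := by
  by_cases hg : g₁ = 0
  · subst hg
    have hf : f₁ = 0 ∨ g₀ = 0 := by
      by_contra! hne
      have := (h (-f₀ / f₁)).1 (by field_simp [hne.1]; ring)
      simp [hne.2] at this
    by_cases hg0 : g₀ = 0
    · subst hg0
      have h0 := (h 0).2 (by simp)
      have h1 := (h 1).2 (by simp)
      exact ⟨0, by linarith, by linarith⟩
    · have hf1 := hf.resolve_right hg0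
      exact ⟨f₀ / g₀, by field_simp, by simp [hf1]⟩
  · have := (h (-g₀ / g₁)).2 (by field_simp; ring)
    refine ⟨f₁ / g₁, ?_, by field_simp⟩
    field_simp at this ⊢
    linarith

lemma affine_cross_mul_eq {f₀ f₁ g₀ g₁ f₀' f₁' g₀' g₁' : ℝ}
    (h : ∀ τ : ℝ, f₀ + f₁ * τ = 0 ↔ g₀ + g₁ * τ = 0)
    (h' : ∀ τ : ℝ, f₀' + f₁' * τ = 0 ↔ g₀' + g₁' * τ = 0)
    (hd : ∀ τ : ℝ, (f₀ + f₁ * τ) * (g₀' + g₁' * τ) = (f₀' + f₁' * τ) * (g₀ + g₁ * τ))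
    (τ σ : ℝ) : (f₀ + f₁ * τ) * (g₀' + g₁' * σ) = (f₀' + f₁' * σ) * (g₀ + g₁ * τ) := by
  obtain ⟨c, rfl, rfl⟩ := exists_eq_mul_of_affine h
  obtain ⟨c', rfl, rfl⟩ := exists_eq_mul_of_affine h'
  by_cases hc : c = c'
  · subst hc; ring
  have key (τ : ℝ) : (g₀ + g₁ * τ) * (g₀' + g₁' * τ) = 0 := by
    refine (mul_eq_zero.1 (?_ : (c - c') * _ = 0)).resolve_left (sub_ne_zero.2 hc)
    linear_combination hd τ
  have k0 := key 0
  have k1 := key 1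
  have k2 := key (-1)
  have e0 : g₀ * g₀' = 0 := by linear_combination k0
  have e2 : g₁ * g₁' = 0 := by linear_combination (k1 + k2) / 2 - k0
  have e1 : g₀ * g₁' + g₁ * g₀' = 0 := by linear_combination (k1 - k2) / 2
  have e3 : g₀ * g₁' = 0 := by
    refine pow_eq_zero_iff (two_ne_zero) |>.1 ?_
    linear_combination (g₀ * g₁') * e1 - g₁ * g₁' * e0
  have e4 : g₁ * g₀' = 0 := by linear_combination e1 - e3
  linear_combination (c - c') * (e0 + σ * e3 + τ * e4 + τ * σ * e2)

lemma exists_affine_transvectionMap (B : V →ₗ[ℝ] V →ₗ[ℝ] ℝ) (φ : V [⋀^Fin n]→ₗ[ℝ] ℝ)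
    (u : V) (x : Fin n → V) :
    ∃ A C : ℝ, ∀ τ, φ (fun i => transvectionMap B u τ (x i)) = A + C * τ := by
  refine ⟨φ x, ∑ i, B (x i) u * φ (Function.update x i u), fun τ => ?_⟩
  simp only [transvectionMap_apply]
  rw [φ.map_add_smul_const, Finset.sum_mul]
  congr 1
  exact Finset.sum_congr rfl fun i _ => by ring

/-- Two alternating forms with the same isotropic zeros are proportional along every family of
isotropic tuples swept out by a word of transvections. -/
lemma mul_eq_mul_transvectionWord {B : V →ₗ[ℝ] V →ₗ[ℝ] ℝ} (hB : B.IsAlt)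
    {h g : V [⋀^Fin n]→ₗ[ℝ] ℝ}
    (H : ∀ x : Fin n → V, (∀ i j, B (x i) (x j) = 0) → (h x = 0 ↔ g x = 0))
    (us : List V) (x : Fin n → V) (hx : ∀ i j, B (x i) (x j) = 0) (t s : ℕ → ℝ) :
    h (fun i => transvectionWord B us t (x i)) * g (fun i => transvectionWord B us s (x i)) =
      h (fun i => transvectionWord B us s (x i)) * g (fun i => transvectionWord B us t (x i)) := by
  induction us generalizing x t s with
  | nil => rfl
  | cons u us ih =>
    have iso (τ : ℝ) : ∀ i j, B (transvectionMap B u τ (x i)) (transvectionMap B u τ (x j)) = 0 :=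
      fun i j => by rw [transvectionMap_preserves hB, hx]
    have isoW (us : List V) : ∀ (t : ℕ → ℝ) (x : Fin n → V), (∀ i j, B (x i) (x j) = 0) →
        ∀ i j, B (transvectionWord B us t (x i)) (transvectionWord B us t (x j)) = 0 := by
      induction us with
      | nil => exact fun t x hx => hx
      | cons u us ih =>
        exact fun t x hx => ih _ (fun i => transvectionMap B u (t 0) (x i))
          fun i j => by rw [transvectionMap_preserves hB, hx]
    have aff (φ : V [⋀^Fin n]→ₗ[ℝ] ℝ) (t : ℕ → ℝ) : ∃ A C : ℝ, ∀ τ,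
        φ (fun i => transvectionWord B us t (transvectionMap B u τ (x i))) = A + C * τ :=
      exists_affine_transvectionMap B (φ.compLinearMap (transvectionWord B us t)) u x
    obtain ⟨f₀, f₁, hf⟩ := aff h (fun k => t (k + 1))
    obtain ⟨f₀', f₁', hf'⟩ := aff h (fun k => s (k + 1))
    obtain ⟨g₀, g₁, hg⟩ := aff g (fun k => t (k + 1))
    obtain ⟨g₀', g₁', hg'⟩ := aff g (fun k => s (k + 1))
    simp only [transvectionWord, LinearMap.comp_apply, hf, hf', hg, hg']
    refine affine_cross_mul_eq (fun τ => ?_) (fun τ => ?_) (fun τ => ?_) _ _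
    · rw [← hf, ← hg]
      exact H _ (isoW us _ _ (iso τ))
    · rw [← hf', ← hg']
      exact H _ (isoW us _ _ (iso τ))
    · rw [← hf, ← hf', ← hg, ← hg']
      exact ih _ (iso τ) _ _

lemma isotropic_span {B : V →ₗ[ℝ] V →ₗ[ℝ] ℝ} {x y : Fin n → V} (h : ∀ i j, B (x i) (y j) = 0)
    {v w : V} (hv : v ∈ Submodule.span ℝ (Set.range x)) (hw : w ∈ Submodule.span ℝ (Set.range y)) :
    B v w = 0 := by
  induction hv, hw using Submodule.span_induction₂ with
  | mem_mem v w hv hw =>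
    obtain ⟨i, rfl⟩ := hv
    obtain ⟨j, rfl⟩ := hw
    exact h i j
  | zero_left => simp
  | zero_right => simp
  | add_left _ _ _ _ _ _ h1 h2 => simp [h1, h2]
  | add_right _ _ _ _ _ _ h1 h2 => simp [h1, h2]
  | smul_left _ _ _ _ _ h1 => simp [h1]
  | smul_right _ _ _ _ _ h1 => simp [h1]

lemma exists_mul_of_mem_span {w : Fin n → V} (hw : LinearIndependent ℝ w) {y : Fin n → V}
    (hy : ∀ i, y i ∈ Submodule.span ℝ (Set.range w)) :
    ∃ d : ℝ, ∀ φ : V [⋀^Fin n]→ₗ[ℝ] ℝ, φ y = φ w * d := by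
  let b := Module.Basis.span hw
  refine ⟨b.det fun i => ⟨y i, hy i⟩, fun φ => ?_⟩
  have := congrArg (fun ψ => ψ fun i => (⟨y i, hy i⟩ : Submodule.span ℝ (Set.range w)))
    ((φ.compLinearMap (Submodule.span ℝ (Set.range w)).subtype).eq_smul_basis_det b)
  simp only [AlternatingMap.smul_apply, smul_eq_mul, AlternatingMap.compLinearMap_apply,
    Submodule.subtype_apply] at this
  rw [this]
  congr 3
  ext i
  simp [b, Module.Basis.span_apply]

variable [FiniteDimensional ℝ V]

lemma finrank_add_finrank_orthogonal_eq {B : V →ₗ[ℝ] V →ₗ[ℝ] ℝ}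
    (hnd : ∀ x, (∀ y, B x y = 0) → x = 0) (W : Submodule ℝ V) :
    Module.finrank ℝ W + Module.finrank ℝ (LinearMap.BilinForm.orthogonal B W) =
      Module.finrank ℝ V := by
  have hker : LinearMap.ker B = ⊥ := by
    rw [LinearMap.ker_eq_bot']
    exact fun x hx => hnd x fun y => by rw [hx, LinearMap.zero_apply]
  have := LinearMap.BilinForm.finrank_add_finrank_orthogonal' (B := B) W
  rwa [hker, inf_bot_eq, finrank_bot, add_zero] at this

/-- A subspace spanned by `n` independent isotropic vectors is its own orthogonal. -/
lemma mem_span_of_orthogonal {B : V →ₗ[ℝ] V →ₗ[ℝ] ℝ}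
    (hnd : ∀ x, (∀ y, B x y = 0) → x = 0) (hdim : Module.finrank ℝ V = 2 * n)
    {x : Fin n → V} (hx : ∀ i j, B (x i) (x j) = 0) (hli : LinearIndependent ℝ x) {z : V}
    (hz : ∀ i, B (x i) z = 0) : z ∈ Submodule.span ℝ (Set.range x) := by
  have h1 : Module.finrank ℝ (Submodule.span ℝ (Set.range x)) = n := by
    rw [finrank_span_eq_card hli, Fintype.card_fin]
  have h2 := finrank_add_finrank_orthogonal_eq hnd (Submodule.span ℝ (Set.range x))
  have h3 : Submodule.span ℝ (Set.range x) =
      LinearMap.BilinForm.orthogonal B (Submodule.span ℝ (Set.range x)) := by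
    refine Submodule.eq_of_le_of_finrank_eq (fun v hv w hw => isotropic_span hx hw hv) ?_
    lia
  rw [h3]
  intro w hw
  exact isotropic_span (y := fun _ : Fin n => z) (fun i _ => hz i) hw <| by
    obtain rfl | hn := n.eq_zero_or_pos
    · have : Subsingleton V := Module.finrank_zero_iff.1 (by simpa using hdim)
      rw [Subsingleton.elim z 0]
      exact Submodule.zero_mem _
    · exact Submodule.subset_span ⟨⟨0, hn⟩, rfl⟩

lemma exists_transvectionWord {B : V →ₗ[ℝ] V →ₗ[ℝ] ℝ} (hB : B.IsAlt)
    (hnd : ∀ x, (∀ y, B x y = 0) → x = 0) (hdim : Module.finrank ℝ V = 2 * n)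
    {y : Fin n → V} (hy : ∀ i j, B (y i) (y j) = 0)
    {x : Fin n → V} (hx : ∀ i j, B (x i) (x j) = 0) (hli : LinearIndependent ℝ x) :
    ∃ us t, LinearIndependent ℝ (fun i => transvectionWord B us t (x i)) ∧
      ∀ i, y i ∈ Submodule.span ℝ (Set.range fun i => transvectionWord B us t (x i)) := by
  classical
  induction hm : (Finset.univ.filter fun i => y i ∉ Submodule.span ℝ (Set.range x)).card
    using Nat.strong_induction_on generalizing x with
  | _ m ih =>
  by_cases hall : ∀ i, y i ∈ Submodule.span ℝ (Set.range x)
  · exact ⟨[], fun _ => 0, hli, hall⟩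
  push Not at hall
  obtain ⟨k, hk⟩ := hall
  obtain ⟨j, hj⟩ : ∃ j, B (x j) (y k) ≠ 0 := by
    by_contra! h
    exact hk (mem_span_of_orthogonal hnd hdim hx hli h)
  set T := transvectionMap B (y k - x j) (B (x j) (y k))⁻¹ with hT
  have hpres := transvectionMap_preserves hB (y k - x j) (B (x j) (y k))⁻¹
  have hTx : T (x j) = y k := by
    rw [hT, transvectionMap_apply, map_sub, hx, sub_zero, inv_mul_cancel₀ hj]
    simp
  have hli' : LinearIndependent ℝ (fun i => T (x i)) :=
    hli.map' T (injective_of_preserves hnd hpres)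
  have hmem (i : Fin n) (hi : y i ∈ Submodule.span ℝ (Set.range x)) :
      y i ∈ Submodule.span ℝ (Set.range fun i => T (x i)) := by
    have h1 : B (y i) (x j) = 0 := isotropic_span hx hi (Submodule.subset_span ⟨j, rfl⟩)
    have h2 : T (y i) = y i := by
      rw [hT, transvectionMap_apply, map_sub, hy, h1]
      simp
    have h3 := Submodule.mem_map_of_mem (f := T) hi
    rw [h2, Submodule.map_span, ← Set.range_comp] at h3
    exact h3
  obtain ⟨us, t, h1, h2⟩ := ih _ (by
    rw [← hm]
    refine Finset.card_lt_card (Finset.ssubset_iff_of_subset ?_ |>.2 ⟨k, ?_, ?_⟩)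
    · intro i
      simp only [Finset.mem_filter, Finset.mem_univ, true_and]
      exact mt (hmem i)
    · simpa using hk
    · simp only [Finset.mem_filter, Finset.mem_univ, true_and, not_not]
      exact Submodule.subset_span ⟨j, hTx⟩) (x := fun i => T (x i))
    (fun i j => by rw [hT, hpres, hx]) hli' rfl
  refine ⟨(y k - x j) :: us, fun i => Nat.casesOn i (B (x j) (y k))⁻¹ t, ?_⟩
  exact ⟨h1, h2⟩

/-- Two alternating `n`-forms with the same isotropic zeros are proportional on isotropic
tuples. -/
lemma mul_eq_mul_of_isotropic {B : V →ₗ[ℝ] V →ₗ[ℝ] ℝ} (hB : B.IsAlt)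
    (hnd : ∀ x, (∀ y, B x y = 0) → x = 0) (hdim : Module.finrank ℝ V = 2 * n)
    {h g : V [⋀^Fin n]→ₗ[ℝ] ℝ}
    (H : ∀ x : Fin n → V, (∀ i j, B (x i) (x j) = 0) → (h x = 0 ↔ g x = 0))
    {x y : Fin n → V} (hx : ∀ i j, B (x i) (x j) = 0) (hy : ∀ i j, B (y i) (y j) = 0) :
    h x * g y = h y * g x := by
  by_cases hli : LinearIndependent ℝ x
  · obtain ⟨us, t, hw, hyw⟩ := exists_transvectionWord hB hnd hdim hy hx hli
    obtain ⟨d, hd⟩ := exists_mul_of_mem_span hw hyw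
    have key := mul_eq_mul_transvectionWord hB H us x hx t (fun _ => 0)
    simp only [transvectionWord_zero, LinearMap.id_apply] at key
    rw [hd, hd]
    linear_combination -d * key
  · rw [h.map_linearDependent _ hli, g.map_linearDependent _ hli]
    ring

/-- A tuple of `n` vectors that is not isotropic is orthogonal to some hyperbolic pair. -/
lemma exists_hyperbolic_pair {B : V →ₗ[ℝ] V →ₗ[ℝ] ℝ} (hB : B.IsAlt)
    (hnd : ∀ x, (∀ y, B x y = 0) → x = 0) (hdim : Module.finrank ℝ V = 2 * n)
    {u : Fin n → V} (hu : ∃ a b, B (u a) (u b) ≠ 0) :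
    ∃ e f, B e f = 1 ∧ (∀ i, B e (u i) = 0) ∧ ∀ i, B f (u i) = 0 := by
  set U := Submodule.span ℝ (Set.range u) with hU
  have huU (i : Fin n) : u i ∈ U := Submodule.subset_span ⟨i, rfl⟩
  have h1 : Module.finrank ℝ U ≤ n :=
    (finrank_range_le_card (R := ℝ) u).trans_eq (Fintype.card_fin n)
  have h2 := finrank_add_finrank_orthogonal_eq hnd U
  have h3 := finrank_add_finrank_orthogonal_eq hnd (LinearMap.BilinForm.orthogonal B U)
  by_cases hex : ∃ e ∈ LinearMap.BilinForm.orthogonal B U,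
      ∃ f ∈ LinearMap.BilinForm.orthogonal B U, B e f ≠ 0
  · obtain ⟨e, he, f, hf, hef⟩ := hex
    refine ⟨(B e f)⁻¹ • e, f, by simp [hef], fun i => ?_, fun i => ?_⟩
    · have : B e (u i) = 0 := by rw [← hB.neg, he _ (huU i), neg_zero]
      simp [this]
    · rw [← hB.neg, hf _ (huU i), neg_zero]
  · push Not at hex
    exfalso
    set W := LinearMap.BilinForm.orthogonal B U
    have h4 : U ≤ LinearMap.BilinForm.orthogonal B W := fun v hv w hw => by
      rw [← hB.neg, hw v hv, neg_zero]
    have h5 : U = LinearMap.BilinForm.orthogonal B W :=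
      Submodule.eq_of_le_of_finrank_eq h4 (by lia)
    have h6 : W ≤ U := by
      rw [h5]
      exact fun v hv w hw => hex w hw v hv
    have h7 : W = U := Submodule.eq_of_le_of_finrank_le h6 (by lia)
    obtain ⟨a, b, hab⟩ := hu
    exact hab (hex _ (h7 ▸ huU a) _ (h7 ▸ huU b))

/-- An alternating form vanishing on isotropic tuples and satisfying the identity expressing
effectiveness vanishes identically. -/
lemma eq_zero_of_isotropic_of_effective {B : V →ₗ[ℝ] V →ₗ[ℝ] ℝ} (hB : B.IsAlt)
    (hnd : ∀ x, (∀ y, B x y = 0) → x = 0) (hdim : Module.finrank ℝ V = 2 * n)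
    {φ : V [⋀^Fin n]→ₗ[ℝ] ℝ}
    (hiso : ∀ x : Fin n → V, (∀ i j, B (x i) (x j) = 0) → φ x = 0)
    (heff : ∀ (e f : V) (u : Fin n → V), B e f = 1 → (∀ i, B e (u i) = 0) →
      (∀ i, B f (u i) = 0) → 2 * φ u + ∑ b, ∑ c ∈ Finset.univ.erase b, B (u b) (u c) *
        φ (Function.update (Function.update u b e) c f) = 0)
    (u : Fin n → V) : φ u = 0 := by
  classical
  induction hm : (Finset.univ.filter fun a => ∃ b, B (u a) (u b) ≠ 0).card
    using Nat.strong_induction_on generalizing u with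
  | _ m ih =>
  subst hm
  by_cases hu : ∃ a b, B (u a) (u b) ≠ 0
  swap
  · push Not at hu
    exact hiso u hu
  obtain ⟨e, f, hef, he, hf⟩ := exists_hyperbolic_pair hB hnd hdim hu
  have hue (i : Fin n) : B (u i) e = 0 := by rw [← hB.neg, he, neg_zero]
  have huf (i : Fin n) : B (u i) f = 0 := by rw [← hB.neg, hf, neg_zero]
  have hfe : B f e = -1 := by rw [← hB.neg, hef]
  have step (x : Fin n → V) (a : Fin n) (ha : ∃ b, B (u a) (u b) ≠ 0)
      (hxa : ∀ b, B (x a) (x b) = 0)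
      (hrad : ∀ c, (∀ b, B (u c) (u b) = 0) → ∀ b, B (x c) (x b) = 0) : φ x = 0 := by
    refine ih _ (Finset.card_lt_card (Finset.ssubset_iff_of_subset ?_ |>.2 ⟨a, ?_, ?_⟩)) x rfl
    · intro c
      simp only [Finset.mem_filter, Finset.mem_univ, true_and]
      contrapose!
      exact hrad c
    · simpa using ha
    · simpa using hxa
  have replace_zero (a : Fin n) (ha : ∃ b, B (u a) (u b) ≠ 0) (z : V)
      (hz : ∀ i, B z (u i) = 0) : φ (Function.update u a z) = 0 := by
    have hz' (i : Fin n) : B (u i) z = 0 := by rw [← hB.neg, hz, neg_zero]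
    refine step _ a ha (fun b => ?_) fun c hc b => ?_
    · rcases eq_or_ne b a with rfl | hb
      · simp [hB z]
      · simp [hb, hz]
    · have hca : c ≠ a := by
        rintro rfl
        exact ha.elim fun b hb => hb (hc b)
      rcases eq_or_ne b a with rfl | hb
      · simp [hca, hz']
      · simp [hca, hb, hc]
  have exchange (a : Fin n) (ha : ∃ b, B (u a) (u b) ≠ 0) :
      ∑ b ∈ Finset.univ.erase a, B (u a) (u b) *
        φ (Function.update (Function.update u a e) b f) = φ u := by
    have hzero : φ (fun b => Function.update u a (u a + e) b + (-B (u a) (u b)) • f) = 0 := by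
      refine step _ a ha (fun b => ?_) fun c hc b => ?_
      · rcases eq_or_ne b a with rfl | hb
        · simp [hB (u b), hue, he, hB e]
        · simp [hb, hB (u a), hef, he, huf]
      · have hca : c ≠ a := by
          rintro rfl
          exact ha.elim fun b hb => hb (hc b)
        have hac : B (u a) (u c) = 0 := by rw [← hB.neg, hc, neg_zero]
        rcases eq_or_ne b a with rfl | hb
        · simp [hca, hac, hc, hue, huf]
        · simp [hca, hb, hac, hc, huf]
    rw [φ.map_add_smul_const, φ.map_update_add, Function.update_eq_self,
      replace_zero a ha e he, ← Finset.add_sum_erase _ _ (Finset.mem_univ a), hB (u a)] at hzero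
    have hsum : ∑ b ∈ Finset.univ.erase a,
        -B (u a) (u b) * φ (Function.update (Function.update u a (u a + e)) b f) =
        - ∑ b ∈ Finset.univ.erase a, B (u a) (u b) *
          φ (Function.update (Function.update u a e) b f) := by
      rw [← Finset.sum_neg_distrib]
      refine Finset.sum_congr rfl fun b hb => ?_
      have hba := Finset.ne_of_mem_erase hb
      by_cases hab : B (u a) (u b) = 0
      · simp [hab]
      have hb' : ∃ c, B (u b) (u c) ≠ 0 :=
        ⟨a, by rw [← hB.neg]; exact neg_ne_zero.2 hab⟩
      rw [Function.update_comm hba.symm, φ.map_update_add, Function.update_comm hba,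
        Function.update_eq_self, replace_zero b hb' f hf, Function.update_comm hba]
      ring
    rw [hsum] at hzero
    linarith
  have h1 := heff e f u hef he hf
  have h2 : ∑ b, ∑ c ∈ Finset.univ.erase b, B (u b) (u c) *
        φ (Function.update (Function.update u b e) c f) =
      ((Finset.univ.filter fun a => ∃ b, B (u a) (u b) ≠ 0).card : ℝ) * φ u := by
    rw [← nsmul_eq_mul, ← Finset.sum_const, Finset.sum_filter]
    refine Finset.sum_congr rfl fun a _ => ?_
    split_ifs with ha
    · exact exchange a ha
    · push Not at ha
      simp [ha]
  rw [h2, ← add_mul] at h1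
  refine (mul_eq_zero.1 h1).resolve_left ?_
  positivity

end LagrangianTuples

/-- Hodge–Lepage–Lychagin, part 2: two effective `n`-forms on a `2n`-dimensional symplectic
vector space vanishing on exactly the same `n`-dimensional isotropic (lagrangian) subspaces
are proportional. -/
theorem effective_forms_proportional [FiniteDimensional ℝ V] (n : ℕ)
    (hdim : Module.finrank ℝ V = 2 * n)
    (Om : EForm V) (hOm : IsSymplecticForm Om)
    (ω₁ ω₂ : EForm V)
    (hω₁ : ω₁ ∈ ⋀[ℝ]^n (Module.Dual ℝ V)) (hω₂ : ω₂ ∈ ⋀[ℝ]^n (Module.Dual ℝ V))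
    (heff₁ : ω₁ * Om = 0) (heff₂ : ω₂ * Om = 0)
    (hsame : ∀ L : Submodule ℝ V, Module.finrank ℝ L = n →
      (∀ x ∈ L, ∀ y ∈ L, formToBilin Om x y = 0) →
      (VanishesOn n ω₁ L ↔ VanishesOn n ω₂ L)) :
    ∃ c : ℝ, ω₂ = c • ω₁ ∨ ω₁ = c • ω₂ := by
  set B := formToBilin Om with hBdef
  have hB : B.IsAlt := formToBilin_self Om
  have H (x : Fin n → V) (hx : ∀ i j, B (x i) (x j) = 0) :
      evalForm n ω₂ x = 0 ↔ evalForm n ω₁ x = 0 := by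
    by_cases hli : LinearIndependent ℝ x
    · have hspan (ω : EForm V) (hω : ω ∈ ⋀[ℝ]^n (Module.Dual ℝ V)) :
          VanishesOn n ω (Submodule.span ℝ (Set.range x)) ↔ evalForm n ω x = 0 := by
        rw [vanishesOn_iff hω]
        refine ⟨fun h => h x fun i => Submodule.subset_span ⟨i, rfl⟩, fun h v hv => ?_⟩
        obtain ⟨d, hd⟩ := exists_mul_of_mem_span hli hv
        rw [hd, h, zero_mul]
      rw [← hspan ω₁ hω₁, ← hspan ω₂ hω₂]
      refine (hsame _ ?_ fun v hv w hw => isotropic_span hx hv hw).symm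
      rw [finrank_span_eq_card hli, Fintype.card_fin]
    · rw [AlternatingMap.map_linearDependent _ _ hli, AlternatingMap.map_linearDependent _ _ hli]
  have eq_zero (η : EForm V) (hη : η ∈ ⋀[ℝ]^n (Module.Dual ℝ V)) (heff : η * Om = 0)
      (hiso : ∀ x : Fin n → V, (∀ i j, B (x i) (x j) = 0) → evalForm n η x = 0) : η = 0 :=
    eq_zero_of_evalForm_eq_zero hη <|
      eq_zero_of_isotropic_of_effective hB hOm.2 hdim hiso fun _ _ _ hef he hf =>
        evalForm_effective hOm.1 heff hef he hf
  by_cases hex : ∃ y : Fin n → V, (∀ i j, B (y i) (y j) = 0) ∧ evalForm n ω₁ y ≠ 0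
  · obtain ⟨y, hy, hy0⟩ := hex
    refine ⟨evalForm n ω₂ y / evalForm n ω₁ y, Or.inl ?_⟩
    rw [← sub_eq_zero]
    refine eq_zero _ (Submodule.sub_mem _ hω₂ (Submodule.smul_mem _ _ hω₁)) ?_ fun x hx => ?_
    · rw [sub_mul, smul_mul_assoc, heff₁, heff₂, smul_zero, sub_zero]
    · have := mul_eq_mul_of_isotropic hB hOm.2 hdim H hx hy
      rw [evalForm_sub_smul]
      field_simp
      linarith
  · push Not at hex
    exact ⟨0, Or.inr (by rw [zero_smul]; exact eq_zero ω₁ hω₁ heff₁ hex)⟩
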